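/- Let (V, ω) be a ℤ-graded conformal vertex algebra and let a ∈ CV ∩ V_{≥2}. Then pr_2(a) ∈ CV ∩ V_2, and for every n ∈ ℤ the eigenspaces V_n^a and V_n^{pr_2(a)} are isomorphic as vector spaces. In particular, if a is a conformal vector of CFT type lying in V_{≥2}, then pr_2(a) is a conformal vector of CFT type. -/

import Mathlib

/-!
Common framework: vertex algebras, ℤ-graded (conformal) vertex algebras,
conformal vectors, automorphism groups, following Moriwaki,
"On classification of conformal vectors in vertex operator algebra and
the vertex algebra automorphism group".
-/

noncomputable section

open scoped BigOperators

/-- The generalized binomial coefficient `binom(m, i)` for `m : ℤ`, valued in a field `K`. -/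
def zBinom (K : Type*) [Field K] (m : ℤ) (i : ℕ) : K :=
  (∏ j ∈ Finset.range i, ((m : K) - (j : K))) / (Nat.factorial i : K)

/-- A vertex algebra over a field `K`: a `K`-vector space `V` equipped with bilinear
`n`-th products `a(n)b` (`n : ℤ`) and a vacuum vector `𝟙`, subject to the truncation
condition, the vacuum and creation axioms, and the Borcherds identity. -/
structure VA (K V : Type*) [Field K] [AddCommGroup V] [Module K V] where
  /-- the `n`-th product `a(n)b`, bilinear in `a` and `b` -/
  ncoef : ℤ → V →ₗ[K] V →ₗ[K] V
  /-- the vacuum vector `𝟙` -/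
  vac : V
  /-- truncation: `a(n)b = 0` for `n` sufficiently large -/
  trunc : ∀ a b : V, ∃ N : ℤ, ∀ n : ℤ, N ≤ n → ncoef n a b = 0
  /-- the vacuum axiom `Y(𝟙, z) = id`, i.e. `𝟙(n)a = δ_{n,-1} a` -/
  vac_ncoef : ∀ (n : ℤ) (a : V), ncoef n vac a = if n = -1 then a else 0
  /-- creation: `a(-1)𝟙 = a` -/
  ncoef_vac : ∀ a : V, ncoef (-1) a vac = a
  /-- creation: `a(n)𝟙 = 0` for `n ≥ 0` -/
  ncoef_vac_zero : ∀ n : ℤ, 0 ≤ n → ∀ a : V, ncoef n a vac = 0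
  /-- the Borcherds identity -/
  borcherds : ∀ (a b c : V) (p q m : ℤ),
    (∑ᶠ i : ℕ, zBinom K m i •
        ncoef (m + q - (i : ℤ)) (ncoef (p + (i : ℤ)) a b) c)
      = ∑ᶠ i : ℕ, ((-1 : K) ^ i * zBinom K p i) •
          (ncoef (m + p - (i : ℤ)) a (ncoef (q + (i : ℤ)) b c)
            - ((p.negOnePow : ℤ) : K) •
                ncoef (p + q - (i : ℤ)) b (ncoef (m + (i : ℤ)) a c))

namespace VA

variable {K V : Type*} [Field K] [AddCommGroup V] [Module K V]

/-- The translation operator `T a = a(-2)𝟙`. -/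
def T (A : VA K V) : V →ₗ[K] V := (A.ncoef (-2)).flip A.vac

/-- The eigenspace `V_n^a = {v ∈ V | a(1)v = n v}` of `a(1)`. -/
def eig (A : VA K V) (a : V) (n : ℤ) : Submodule K V :=
  LinearMap.ker (A.ncoef 1 a - (n : K) • (LinearMap.id : V →ₗ[K] V))

/-- `a` is a conformal vector: `a(1)a = 2a`, `a(3)a ∈ K𝟙`, `a(2)a = 0`, `a(n)a = 0`
for `n ≥ 4`, `a(0) = T`, and `a(1)` is semisimple with integer eigenvalues
(`V = ⊕_{n ∈ ℤ} V_n^a`). -/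
def IsConformal (A : VA K V) (a : V) : Prop :=
  A.ncoef 1 a a = (2 : K) • a ∧
  (∃ c : K, A.ncoef 3 a a = c • A.vac) ∧
  A.ncoef 2 a a = 0 ∧
  (∀ n : ℤ, 4 ≤ n → A.ncoef n a a = 0) ∧
  A.ncoef 0 a = A.T ∧
  DirectSum.IsInternal (A.eig a)

/-- `a` is a conformal vector of CFT type: `(V, a)` is a VOA of CFT type, i.e.
`V = ⊕_{n ∈ ℕ} V_n^a` with finite-dimensional pieces and `V_0^a = K𝟙`. -/
def IsConformalCFT (A : VA K V) (a : V) : Prop :=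
  A.IsConformal a ∧
  (∀ n : ℤ, n < 0 → A.eig a n = ⊥) ∧
  (∀ n : ℤ, FiniteDimensional K (A.eig a n)) ∧
  A.eig a 0 = Submodule.span K {A.vac}

/-- `a` is a conformal vector of strong CFT type: of CFT type and `a(2)V_1^a = 0`
(i.e. `L^a(1) V_1^a = 0`). -/
def IsConformalSCFT (A : VA K V) (a : V) : Prop :=
  A.IsConformalCFT a ∧ ∀ v ∈ A.eig a 1, A.ncoef 2 a v = 0

/-- A vertex algebra homomorphism: a linear map preserving all products and the vacuum. -/
structure IsVAHom (A : VA K V) (f : V → V) : Prop where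
  map_add : ∀ a b : V, f (a + b) = f a + f b
  map_smul : ∀ (c : K) (a : V), f (c • a) = c • f a
  map_ncoef : ∀ (n : ℤ) (a b : V), f (A.ncoef n a b) = A.ncoef n (f a) (f b)
  map_vac : f A.vac = A.vac

/-- A vertex algebra automorphism: a bijective vertex algebra homomorphism. -/
def IsVAAut (A : VA K V) (f : V → V) : Prop :=
  A.IsVAHom f ∧ Function.Bijective f

/-- A (two-sided) ideal of a vertex algebra. -/
def IsIdeal (A : VA K V) (I : Submodule K V) : Prop :=
  ∀ (n : ℤ) (a : V), ∀ b ∈ I, A.ncoef n a b ∈ I ∧ A.ncoef n b a ∈ I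

/-- A vertex algebra is simple if it has no ideals other than `0` and itself. -/
def IsSimple (A : VA K V) : Prop :=
  ∀ I : Submodule K V, A.IsIdeal I → I = ⊥ ∨ I = ⊤

end VA

/-- The exponential `exp f = Σ_{n≥0} f^n / n!` of an endomorphism, as a function
(meaningful for locally nilpotent `f`). -/
def expOp {K V : Type*} [Field K] [AddCommGroup V] [Module K V]
    (f : V →ₗ[K] V) (v : V) : V :=
  ∑ᶠ n : ℕ, (Nat.factorial n : K)⁻¹ • (f ^ n) v

/-- A ℤ-grading on a vertex algebra, making it a ℤ-graded vertex algebra: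
`V = ⊕_{n ∈ ℤ} V_n`, `V_n(k)V_m ⊆ V_{n+m-k-1}` and `𝟙 ∈ V_0`. -/
structure GradedVA {K V : Type*} [Field K] [AddCommGroup V] [Module K V] (A : VA K V) where
  /-- the grading subspaces `V_n` -/
  gr : ℤ → Submodule K V
  /-- `V = ⊕_{n ∈ ℤ} V_n` -/
  decomp : DirectSum.Decomposition gr
  /-- `𝟙 ∈ V_0` -/
  vac_mem : A.vac ∈ gr 0
  /-- `V_n(k)V_m ⊆ V_{n+m-k-1}` -/
  ncoef_mem : ∀ (n m k : ℤ), ∀ a ∈ gr n, ∀ b ∈ gr m, A.ncoef k a b ∈ gr (n + m - k - 1)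

namespace GradedVA

variable {K V : Type*} [Field K] [AddCommGroup V] [Module K V] {A : VA K V}

/-- The canonical projection `pr_n : V → V_n`. -/
def pr (G : GradedVA A) (n : ℤ) (v : V) : V :=
  letI := G.decomp
  (DirectSum.decompose G.gr v n : V)

/-- `V_{≥n} = ⊕_{i ≥ n} V_i`. -/
def ge (G : GradedVA A) (n : ℤ) : Submodule K V := ⨆ i ≥ n, G.gr i

/-- `V_{≤n} = ⊕_{i ≤ n} V_i`. -/
def le (G : GradedVA A) (n : ℤ) : Submodule K V := ⨆ i ≤ n, G.gr i

/-- `J_1(V) = {a ∈ V_1 | a(0) = 0}`. -/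
def J1 (G : GradedVA A) : Set V :=
  {a : V | a ∈ G.gr 1 ∧ A.ncoef 0 a = 0}

/-- `Aut⁺V`: automorphisms `f` with `f(V_n) ⊆ V_{≥n}` and `pr_n ∘ f|_{V_n} = id`. -/
def AutPlus (G : GradedVA A) (f : V → V) : Prop :=
  A.IsVAAut f ∧ ∀ n : ℤ, ∀ v ∈ G.gr n, f v ∈ G.ge n ∧ G.pr n (f v) = v

/-- `Aut⁻V`: automorphisms `f` with `f(V_n) ⊆ ⊕_{k ≤ n} V_k` and `pr_n ∘ f|_{V_n} = id`. -/
def AutMinus (G : GradedVA A) (f : V → V) : Prop :=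
  A.IsVAAut f ∧ ∀ n : ℤ, ∀ v ∈ G.gr n, f v ∈ G.le n ∧ G.pr n (f v) = v

/-- `Aut⁰V`: automorphisms `f` with `f(V_n) ⊆ V_n`. -/
def AutZero (G : GradedVA A) (f : V → V) : Prop :=
  A.IsVAAut f ∧ ∀ n : ℤ, ∀ v ∈ G.gr n, f v ∈ G.gr n

end GradedVA

/-- A ℤ-graded conformal vertex algebra: a ℤ-graded vertex algebra with a conformal
vector `ω ∈ V_2` whose modes `L(n) = ω(n+1)` satisfy the Virasoro relations, with
`L(0)v = n v` for `v ∈ V_n` and `L(-1) = T`. -/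
structure ConfGVA {K V : Type*} [Field K] [AddCommGroup V] [Module K V] (A : VA K V)
    extends GradedVA A where
  /-- the conformal vector -/
  ω : V
  ω_mem : ω ∈ gr 2
  /-- the Virasoro relations `[L(n), L(m)] = (n-m)L(n+m) + δ_{n+m,0}((n³-n)/12)c` -/
  virasoro : ∃ c : K, ∀ n m : ℤ,
    A.ncoef (n + 1) ω ∘ₗ A.ncoef (m + 1) ω - A.ncoef (m + 1) ω ∘ₗ A.ncoef (n + 1) ω
      = ((n : K) - (m : K)) • A.ncoef (n + m + 1) ω
        + (if n + m = 0 then ((n : K) ^ 3 - (n : K)) / 12 * c else 0)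
            • (LinearMap.id : V →ₗ[K] V)
  /-- `L(0) v = n v` for `v ∈ V_n` -/
  L0_grading : ∀ n : ℤ, ∀ v ∈ gr n, A.ncoef 1 ω v = (n : K) • v
  /-- `L(-1) = T` -/
  Lneg1_eq_T : A.ncoef 0 ω = A.T

namespace ConfGVA

variable {K V : Type*} [Field K] [AddCommGroup V] [Module K V] {A : VA K V}

abbrev pr (C : ConfGVA A) : ℤ → V → V := C.toGradedVA.pr
abbrev ge (C : ConfGVA A) : ℤ → Submodule K V := C.toGradedVA.ge
abbrev le (C : ConfGVA A) : ℤ → Submodule K V := C.toGradedVA.le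
abbrev J1 (C : ConfGVA A) : Set V := C.toGradedVA.J1
abbrev AutPlus (C : ConfGVA A) : (V → V) → Prop := C.toGradedVA.AutPlus
abbrev AutMinus (C : ConfGVA A) : (V → V) → Prop := C.toGradedVA.AutMinus
abbrev AutZero (C : ConfGVA A) : (V → V) → Prop := C.toGradedVA.AutZero

/-- `Aut_ω V`: the VOA automorphisms, i.e. the stabilizer of `ω` in `Aut V`. -/
def AutOmega (C : ConfGVA A) (f : V → V) : Prop :=
  A.IsVAAut f ∧ f C.ω = C.ω

/-- An invariant bilinear form on `(V, ω)`:
`(a(n)b, c) = (-1)^d Σ_{j≥0} (1/j!) (b, (L(1)^j a)(2d-n-2-j) c)` for `a ∈ V_d`, which is the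
coefficient form of `(Y(a,z)b, c) = (b, Y(e^{zL(1)}(-z^{-2})^{L(0)} a, z^{-1}) c)`. -/
def IsInvForm (C : ConfGVA A) (B : V →ₗ[K] V →ₗ[K] K) : Prop :=
  ∀ d : ℤ, ∀ a ∈ C.gr d, ∀ (b c : V) (n : ℤ),
    B (A.ncoef n a b) c
      = ((d.negOnePow : ℤ) : K) *
          ∑ᶠ j : ℕ, (Nat.factorial j : K)⁻¹ *
            B b (A.ncoef (2 * d - n - 2 - (j : ℤ)) ((A.ncoef 2 C.ω ^ j) a) c)

end ConfGVA

/-- A VOA of CFT type: a ℤ-graded conformal vertex algebra with `V = ⊕_{n ∈ ℕ} V_n`,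
`dim V_n < ∞`, and `V_0 = K𝟙`. -/
structure VOACFT {K V : Type*} [Field K] [AddCommGroup V] [Module K V] (A : VA K V)
    extends ConfGVA A where
  gr_neg : ∀ n : ℤ, n < 0 → gr n = ⊥
  gr_fd : ∀ n : ℤ, FiniteDimensional K (gr n)
  gr_zero : gr 0 = Submodule.span K {A.vac}

namespace VOACFT

variable {K V : Type*} [Field K] [AddCommGroup V] [Module K V] {A : VA K V}

abbrev pr (W : VOACFT A) : ℤ → V → V := W.toConfGVA.pr
abbrev ge (W : VOACFT A) : ℤ → Submodule K V := W.toConfGVA.ge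
abbrev le (W : VOACFT A) : ℤ → Submodule K V := W.toConfGVA.le
abbrev J1 (W : VOACFT A) : Set V := W.toConfGVA.J1
abbrev AutPlus (W : VOACFT A) : (V → V) → Prop := W.toConfGVA.AutPlus
abbrev AutMinus (W : VOACFT A) : (V → V) → Prop := W.toConfGVA.AutMinus
abbrev AutZero (W : VOACFT A) : (V → V) → Prop := W.toConfGVA.AutZero
abbrev AutOmega (W : VOACFT A) : (V → V) → Prop := W.toConfGVA.AutOmega
abbrev IsInvForm (W : VOACFT A) : (V →ₗ[K] V →ₗ[K] K) → Prop := W.toConfGVA.IsInvForm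

end VOACFT

/-- A VOA of strong CFT type: a VOA of CFT type with `L(1)V_1 = 0`. -/
structure VOAsCFT {K V : Type*} [Field K] [AddCommGroup V] [Module K V] (A : VA K V)
    extends VOACFT A where
  L1_V1 : ∀ v ∈ gr 1, A.ncoef 2 ω v = 0

namespace VOAsCFT

variable {K V : Type*} [Field K] [AddCommGroup V] [Module K V] {A : VA K V}

abbrev pr (W : VOAsCFT A) : ℤ → V → V := W.toVOACFT.pr
abbrev ge (W : VOAsCFT A) : ℤ → Submodule K V := W.toVOACFT.ge
abbrev le (W : VOAsCFT A) : ℤ → Submodule K V := W.toVOACFT.le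
abbrev J1 (W : VOAsCFT A) : Set V := W.toVOACFT.J1
abbrev AutPlus (W : VOAsCFT A) : (V → V) → Prop := W.toVOACFT.AutPlus
abbrev AutMinus (W : VOAsCFT A) : (V → V) → Prop := W.toVOACFT.AutMinus
abbrev AutZero (W : VOAsCFT A) : (V → V) → Prop := W.toVOACFT.AutZero
abbrev AutOmega (W : VOAsCFT A) : (V → V) → Prop := W.toVOACFT.AutOmega
abbrev IsInvForm (W : VOAsCFT A) : (V →ₗ[K] V →ₗ[K] K) → Prop := W.toVOACFT.IsInvForm

end VOAsCFT

end

namespace Module.End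

variable {K V : Type*} [Field K] [AddCommGroup V] [Module K V]

/-- If a sum of eigenvectors with distinct eigenvalues lies in an invariant subspace, so does
each of them. -/
theorem mem_of_sum_eigenvectors_mem [CharZero K] {f : Module.End K V} {W : Submodule K V}
    (hW : ∀ v ∈ W, f v ∈ W) (s : Finset ℤ) (x : ℤ → V)
    (hx : ∀ k, f (x k) = (k : K) • x k) (hs : ∑ k ∈ s, x k ∈ W) :
    ∀ k ∈ s, x k ∈ W := by
  induction s using Finset.induction_on generalizing x with
  | empty => simp
  | insert j s hj ih =>
    have hmem : ∀ k ∈ s, x k ∈ W := by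
      intro k hk
      have key : ∑ i ∈ s, ((i : K) - (j : K)) • x i ∈ W := by
        have h := W.sub_mem (hW _ hs) (W.smul_mem (j : K) hs)
        rw [map_sum, Finset.smul_sum, ← Finset.sum_sub_distrib] at h
        simp only [hx, ← sub_smul] at h
        rwa [Finset.sum_insert hj, sub_self, zero_smul, zero_add] at h
      have h := ih (fun i => ((i : K) - (j : K)) • x i)
        (fun i => by rw [map_smul, hx, smul_comm]) key k hk
      have hne : (k : K) - (j : K) ≠ 0 := by
        rw [sub_ne_zero]
        exact fun e => hj (Int.cast_injective e ▸ hk)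
      exact (W.smul_mem_iff hne).1 h
    intro k hk
    rcases Finset.mem_insert.1 hk with rfl | hk
    · rw [Finset.sum_insert hj] at hs
      exact (W.add_mem_iff_left (W.sum_mem hmem)).1 hs
    · exact hmem k hk

/-- The projections onto the eigenspaces of a diagonalizable operator with integer eigenvalues. -/
theorem exists_eigenprojections {f : Module.End K V}
    (hf : DirectSum.IsInternal fun n : ℤ => f.eigenspace (n : K)) :
    ∃ π : ℤ → V →ₗ[K] V, (∀ k v, f (π k v) = (k : K) • π k v) ∧
      ∀ v, ∃ s : Finset ℤ, ∑ k ∈ s, π k v = v := by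
  classical
  let D := hf.chooseDecomposition
  refine ⟨fun k => (f.eigenspace (k : K)).subtype ∘ₗ
    DirectSum.component K ℤ (fun n : ℤ => f.eigenspace (n : K)) k ∘ₗ
    (DirectSum.decomposeLinearEquiv (fun n : ℤ => f.eigenspace (n : K))).toLinearMap,
    fun k v => ?_, fun v => ?_⟩
  · exact mem_eigenspace_iff.1
      (DirectSum.decompose (fun n : ℤ => f.eigenspace (n : K)) v k).2
  · exact ⟨_, DirectSum.sum_support_decompose (fun n : ℤ => f.eigenspace (n : K)) v⟩

/-- Two diagonalizable operators that preserve an exhaustive and separated decreasing filtration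
and agree on its graded pieces: the eigenspaces of one embed into those of the other. -/
theorem rank_eigenspace_le [CharZero K] {f g : Module.End K V} {F : ℤ → Submodule K V}
    (hf : DirectSum.IsInternal fun n : ℤ => f.eigenspace (n : K))
    (hF : ∀ m, ∀ v ∈ F m, f v ∈ F m) (hfg : ∀ m, ∀ v ∈ F m, f v - g v ∈ F (m + 1))
    (hex : ∀ v, ∃ m, v ∈ F m) (hsep : ∀ v, (∀ m, v ∈ F m) → v = 0)
    (hanti : Antitone F) (n : ℤ) :
    Module.rank K (g.eigenspace (n : K)) ≤ Module.rank K (f.eigenspace (n : K)) := by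
  obtain ⟨π, hπ, hsum⟩ := exists_eigenprojections hf
  refine LinearMap.rank_le_of_injective
    (((π n).domRestrict (g.eigenspace (n : K))).codRestrict (f.eigenspace (n : K))
      fun v => mem_eigenspace_iff.2 (hπ n v)) ?_
  rw [injective_iff_map_eq_zero]
  rintro ⟨v, hv⟩ h0
  have hv0 : π n v = 0 := congrArg Subtype.val h0
  rw [mem_eigenspace_iff] at hv
  have step : ∀ m, v ∈ F m → v ∈ F (m + 1) := by
    intro m hm
    obtain ⟨s, hs⟩ := hsum v
    have h1 : ∑ k ∈ s, ((k : K) - (n : K)) • π k v ∈ F (m + 1) := by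
      have h := hfg m v hm
      have e : f v - g v = ∑ k ∈ s, ((k : K) - (n : K)) • π k v := by
        simp only [sub_smul, Finset.sum_sub_distrib, ← Finset.smul_sum, hs, hv, ← hπ, ← map_sum]
      rwa [e] at h
    have h2 := mem_of_sum_eigenvectors_mem (hF (m + 1)) s _
      (fun k => by rw [map_smul, hπ, smul_comm]) h1
    rw [← hs]
    refine (F (m + 1)).sum_mem fun k hk => ?_
    by_cases hkn : k = n
    · rw [hkn, hv0]
      exact zero_mem _
    · refine ((F (m + 1)).smul_mem_iff ?_).1 (h2 k hk)
      rw [sub_ne_zero]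
      exact fun e => hkn (Int.cast_injective e)
  obtain ⟨m, hm⟩ := hex v
  have hall : ∀ d : ℕ, v ∈ F (m + d) := by
    intro d
    induction d with
    | zero => simpa using hm
    | succ d ih => simpa [add_assoc] using step _ ih
  refine Subtype.ext (hsep v fun k => ?_)
  exact hanti (by omega : k ≤ m + ((k - m).toNat : ℤ)) (hall _)

end Module.End

namespace GradedVA

variable {K V : Type*} [Field K] [AddCommGroup V] [Module K V] {A : VA K V}

/-- The projection `pr_n` as a linear map. -/
def prLinear (G : GradedVA A) (n : ℤ) : V →ₗ[K] V :=
  letI := G.decomp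
  (G.gr n).subtype ∘ₗ DirectSum.component K ℤ (fun i => G.gr i) n ∘ₗ
    (DirectSum.decomposeLinearEquiv G.gr).toLinearMap

theorem prLinear_apply (G : GradedVA A) (n : ℤ) (v : V) : G.prLinear n v = G.pr n v := rfl

theorem pr_mem (G : GradedVA A) (n : ℤ) (v : V) : G.pr n v ∈ G.gr n :=
  let := G.decomp
  (DirectSum.decompose G.gr v n).2

theorem pr_of_mem (G : GradedVA A) {n : ℤ} {v : V} (hv : v ∈ G.gr n) : G.pr n v = v :=
  let := G.decomp
  DirectSum.decompose_of_mem_same G.gr hv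

theorem pr_of_mem_ne (G : GradedVA A) {n m : ℤ} {v : V} (hv : v ∈ G.gr n) (h : n ≠ m) :
    G.pr m v = 0 :=
  let := G.decomp
  DirectSum.decompose_of_mem_ne G.gr hv h

theorem exists_sum_pr (G : GradedVA A) (v : V) :
    ∃ s : Finset ℤ, ∑ k ∈ s, G.pr k v = v := by
  classical
  let := G.decomp
  exact ⟨_, DirectSum.sum_support_decompose G.gr v⟩

theorem gr_le_ge (G : GradedVA A) {m n : ℤ} (h : n ≤ m) : G.gr m ≤ G.ge n :=
  le_iSup₂_of_le (f := fun i (_ : i ≥ n) => G.gr i) m h le_rfl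

theorem ge_antitone (G : GradedVA A) : Antitone G.ge :=
  fun _ _ h => iSup₂_le fun _ hi => G.gr_le_ge (h.trans hi)

theorem mem_ge_iff (G : GradedVA A) {n : ℤ} {v : V} :
    v ∈ G.ge n ↔ ∀ i < n, G.pr i v = 0 := by
  constructor
  · intro hv i hi
    have h : G.ge n ≤ LinearMap.ker (G.prLinear i) :=
      iSup₂_le fun j hj x hx => G.pr_of_mem_ne hx (by omega)
    exact h hv
  · intro h
    obtain ⟨s, hs⟩ := G.exists_sum_pr v
    rw [← hs]
    refine (G.ge n).sum_mem fun k _ => ?_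
    by_cases hk : k < n
    · rw [h k hk]
      exact zero_mem _
    · exact G.gr_le_ge (not_lt.1 hk) (G.pr_mem k v)

theorem sub_pr_mem_ge (G : GradedVA A) {n : ℤ} {v : V} (hv : v ∈ G.ge n) :
    v - G.pr n v ∈ G.ge (n + 1) := by
  rw [mem_ge_iff] at hv ⊢
  intro i hi
  rw [← prLinear_apply, map_sub, prLinear_apply, prLinear_apply]
  rcases (by omega : i < n ∨ i = n) with h | rfl
  · rw [hv i h, G.pr_of_mem_ne (G.pr_mem n v) h.ne', sub_zero]
  · rw [G.pr_of_mem (G.pr_mem i v), sub_self]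

theorem exists_mem_ge (G : GradedVA A) (v : V) : ∃ m, v ∈ G.ge m := by
  obtain ⟨s, hs⟩ := G.exists_sum_pr v
  obtain ⟨m, hm⟩ := s.bddBelow
  refine ⟨m, ?_⟩
  rw [← hs]
  exact (G.ge m).sum_mem fun k hk => G.gr_le_ge (hm hk) (G.pr_mem k v)

theorem eq_zero_of_forall_mem_ge (G : GradedVA A) (v : V) (h : ∀ m, v ∈ G.ge m) : v = 0 := by
  obtain ⟨s, hs⟩ := G.exists_sum_pr v
  rw [← hs]
  exact Finset.sum_eq_zero fun k _ => G.mem_ge_iff.1 (h (k + 1)) k (by omega)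

theorem ncoef_mem_ge (G : GradedVA A) {p q : ℤ} {a v : V} (ha : a ∈ G.ge p) (hv : v ∈ G.ge q)
    (k : ℤ) : A.ncoef k a v ∈ G.ge (p + q - k - 1) := by
  have h : G.ge q ≤ (G.ge (p + q - k - 1)).comap (A.ncoef k a) := by
    refine iSup₂_le fun j hj x hx => ?_
    have h' : G.ge p ≤ (G.ge (p + q - k - 1)).comap ((A.ncoef k).flip x) :=
      iSup₂_le fun i hi y hy => G.gr_le_ge (by omega) (G.ncoef_mem i j k y hy x hx)
    exact h' ha
  exact h hv

/-- The leading term of a product is the product of the leading terms. -/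
theorem ncoef_sub_ncoef_pr_mem_ge (G : GradedVA A) {p q : ℤ} {a v : V} (ha : a ∈ G.ge p)
    (hv : v ∈ G.ge q) (k : ℤ) :
    A.ncoef k a v - A.ncoef k (G.pr p a) (G.pr q v) ∈ G.ge (p + q - k) := by
  have h1 := G.ncoef_mem_ge (G.sub_pr_mem_ge ha) hv k
  have h2 := G.ncoef_mem_ge (G.gr_le_ge le_rfl (G.pr_mem p a)) (G.sub_pr_mem_ge hv) k
  rw [show p + 1 + q - k - 1 = p + q - k by ring] at h1
  rw [show p + (q + 1) - k - 1 = p + q - k by ring] at h2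
  convert add_mem h1 h2 using 1
  simp only [map_sub, LinearMap.sub_apply]
  abel

theorem pr_ncoef (G : GradedVA A) {p q : ℤ} {a v : V} (ha : a ∈ G.ge p) (hv : v ∈ G.ge q)
    (k : ℤ) :
    G.pr (p + q - k - 1) (A.ncoef k a v) = A.ncoef k (G.pr p a) (G.pr q v) := by
  have h := G.mem_ge_iff.1 (G.ncoef_sub_ncoef_pr_mem_ge ha hv k) (p + q - k - 1) (by omega)
  rw [← prLinear_apply, map_sub, prLinear_apply, prLinear_apply,
    G.pr_of_mem (G.ncoef_mem p q k _ (G.pr_mem p a) _ (G.pr_mem q v))] at h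
  exact sub_eq_zero.1 h

theorem hom_ext (G : GradedVA A) {f g : V →ₗ[K] V} (h : ∀ m, ∀ v ∈ G.gr m, f v = g v) :
    f = g := by
  ext v
  obtain ⟨s, hs⟩ := G.exists_sum_pr v
  rw [← hs, map_sum, map_sum]
  exact Finset.sum_congr rfl fun k _ => h k _ (G.pr_mem k v)

end GradedVA

theorem VA.eig_eq_eigenspace {K V : Type*} [Field K] [AddCommGroup V] [Module K V]
    (A : VA K V) (a : V) :
    A.eig a = fun n : ℤ => Module.End.eigenspace (A.ncoef 1 a) (n : K) := by
  funext n
  ext v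
  simp [VA.eig, sub_eq_zero]

namespace GradedVA

variable {K V : Type*} [Field K] [CharZero K] [AddCommGroup V] [Module K V] {A : VA K V}

/-- Passing to the leading term of `a ∈ V_{≥2}` preserves diagonalizability of `a(1)`. -/
theorem isInternal_eig_pr (G : GradedVA A) {a : V} (ha : a ∈ G.ge 2)
    (h : DirectSum.IsInternal (A.eig a)) : DirectSum.IsInternal (A.eig (G.pr 2 a)) := by
  rw [VA.eig_eq_eigenspace] at h ⊢
  refine DirectSum.isInternal_submodule_of_iSupIndep_of_iSup_eq_top
    ((Module.End.eigenspaces_iSupIndep (A.ncoef 1 (G.pr 2 a))).comp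
      (Int.cast_injective (α := K))) ?_
  rw [eq_top_iff]
  rintro v -
  obtain ⟨t, ht⟩ := G.exists_sum_pr v
  rw [← ht]
  refine Submodule.sum_mem _ fun m _ => ?_
  obtain ⟨π, hπ, hsum⟩ := Module.End.exists_eigenprojections h
  have hinv : ∀ w ∈ G.ge m, A.ncoef 1 a w ∈ G.ge m := fun w hw => by
    simpa using G.ge_antitone (by omega) (G.ncoef_mem_ge ha hw 1)
  have hw : G.pr m v ∈ G.gr m := G.pr_mem m v
  generalize G.pr m v = w at hw
  obtain ⟨s, hs⟩ := hsum w
  have hmem := Module.End.mem_of_sum_eigenvectors_mem hinv s (fun k => π k w)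
    (fun k => hπ k w) (hs.symm ▸ G.gr_le_ge le_rfl hw)
  have hsum_pr : ∑ k ∈ s, G.pr m (π k w) = w := by
    simp only [← prLinear_apply]
    rw [← map_sum, hs, prLinear_apply, G.pr_of_mem hw]
  rw [← hsum_pr]
  refine Submodule.sum_mem _ fun k hk => Submodule.mem_iSup_of_mem k ?_
  rw [Module.End.mem_eigenspace_iff, ← G.pr_ncoef ha (hmem k hk), hπ,
    show 2 + m - 1 - 1 = m by ring, ← prLinear_apply, map_smul,
    prLinear_apply]

theorem rank_eig_pr (G : GradedVA A) {a : V} (ha : a ∈ G.ge 2)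
    (h : DirectSum.IsInternal (A.eig a)) (n : ℤ) :
    Module.rank K (A.eig a n) = Module.rank K (A.eig (G.pr 2 a) n) := by
  have h' := G.isInternal_eig_pr ha h
  have inv : ∀ b ∈ G.ge 2, ∀ m, ∀ v ∈ G.ge m, A.ncoef 1 b v ∈ G.ge m := fun b hb m v hv =>
    G.ge_antitone (by omega) (G.ncoef_mem_ge hb hv 1)
  have diff : ∀ m, ∀ v ∈ G.ge m, A.ncoef 1 a v - A.ncoef 1 (G.pr 2 a) v ∈ G.ge (m + 1) := by
    intro m v hv
    have := G.ncoef_mem_ge (G.sub_pr_mem_ge ha) hv 1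
    rw [map_sub, LinearMap.sub_apply] at this
    exact G.ge_antitone (by omega) this
  rw [VA.eig_eq_eigenspace] at h h'
  rw [VA.eig_eq_eigenspace, VA.eig_eq_eigenspace]
  refine le_antisymm ?_ ?_
  · refine Module.End.rank_eigenspace_le h' (inv _ (G.gr_le_ge le_rfl (G.pr_mem 2 a))) ?_
      G.exists_mem_ge G.eq_zero_of_forall_mem_ge G.ge_antitone n
    intro m v hv
    rw [← neg_sub]
    exact neg_mem (diff m v hv)
  · exact Module.End.rank_eigenspace_le h (inv a ha) diff
      G.exists_mem_ge G.eq_zero_of_forall_mem_ge G.ge_antitone n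

end GradedVA

theorem ConfGVA.isConformal_pr {K V : Type*} [Field K] [CharZero K] [AddCommGroup V] [Module K V]
    {A : VA K V} (C : ConfGVA A) {a : V} (hc : A.IsConformal a) (ha : a ∈ C.ge 2) :
    A.IsConformal (C.pr 2 a) := by
  obtain ⟨h1, ⟨c, h3⟩, h2, h4, h0, hI⟩ := hc
  refine ⟨?_, ⟨c, ?_⟩, ?_, fun n hn => ?_, ?_, C.isInternal_eig_pr ha hI⟩
  · rw [← C.pr_ncoef ha ha, h1, show (2 : ℤ) + 2 - 1 - 1 = 2 by ring, ← C.prLinear_apply,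
      map_smul, C.prLinear_apply]
  · rw [← C.pr_ncoef ha ha, h3, show (2 : ℤ) + 2 - 3 - 1 = 0 by ring,
      C.pr_of_mem (Submodule.smul_mem _ _ C.vac_mem)]
  · rw [← C.pr_ncoef ha ha, h2, ← C.prLinear_apply, map_zero]
  · rw [← C.pr_ncoef ha ha, h4 n hn, ← C.prLinear_apply, map_zero]
  · refine C.hom_ext fun m v hv => ?_
    have h := C.pr_ncoef ha (C.gr_le_ge le_rfl hv) 0
    rw [C.pr_of_mem hv] at h
    rw [← h, h0, ← C.Lneg1_eq_T]
    exact C.pr_of_mem (C.ncoef_mem 2 m 0 _ C.ω_mem _ hv)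

/-- Lemma `pr2` and Corollary `rem_cft`: if `a ∈ CV ∩ V_{≥2}`, then
`pr_2(a) ∈ CV ∩ V_2` and `V_n^a ≅ V_n^{pr_2(a)}` as vector spaces for all `n`;
in particular if `a` is of CFT type then so is `pr_2(a)`. -/
theorem pr2_conformal {K V : Type*} [RCLike K] [AddCommGroup V] [Module K V]
    (A : VA K V) (C : ConfGVA A) (a : V)
    (hc : A.IsConformal a) (ha : a ∈ C.ge 2) :
    (A.IsConformal (C.pr 2 a) ∧ C.pr 2 a ∈ C.gr 2) ∧
    (∀ n : ℤ, Nonempty ((A.eig a n) ≃ₗ[K] (A.eig (C.pr 2 a) n))) ∧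
    (A.IsConformalCFT a → A.IsConformalCFT (C.pr 2 a)) := by
  have hb := C.isConformal_pr hc ha
  have he : ∀ n : ℤ, Nonempty ((A.eig a n) ≃ₗ[K] (A.eig (C.pr 2 a) n)) := fun n =>
    nonempty_linearEquiv_of_rank_eq (C.rank_eig_pr ha hc.2.2.2.2.2 n)
  refine ⟨⟨hb, C.pr_mem 2 a⟩, he, fun ⟨_, hneg, hfd, hzero⟩ => ⟨hb, fun n hn => ?_, fun n => ?_, ?_⟩⟩
  · obtain ⟨e⟩ := he n
    have : Subsingleton (A.eig a n) := Submodule.subsingleton_iff_eq_bot.2 (hneg n hn)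
    exact Submodule.subsingleton_iff_eq_bot.1 e.symm.toEquiv.subsingleton
  · obtain ⟨e⟩ := he n
    have := hfd n
    exact Module.Finite.equiv e
  · obtain ⟨e⟩ := he 0
    have := hfd 0
    have : FiniteDimensional K (A.eig (C.pr 2 a) 0) := Module.Finite.equiv e
    refine (Submodule.eq_of_le_of_finrank_eq ?_ ?_).symm
    · rw [Submodule.span_singleton_le_iff_mem]
      simp [VA.eig, A.ncoef_vac_zero 1 (by norm_num)]
    · rw [← hzero]
      exact e.finrank_eq
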